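/- For every Θ > 0, the ground-state level m_Θ satisfies 0 < m_Θ < ∞; that is, the set V_Θ is nonempty, I is bounded below on V_Θ, and its infimum over V_Θ is strictly positive. -/

import Mathlib

noncomputable section

open MeasureTheory Real Filter

namespace Waveguide

/-- A point of the waveguide `ℝ³ × 𝕋`, modelled as `ℝ³ × ℝ` with functions that are
`2π`-periodic in the second coordinate. -/
abbrev Pt : Type := (Fin 3 → ℝ) × ℝ

/-- The fundamental domain `ℝ³ × (0, 2π]` of the waveguide `ℝ³ × 𝕋`. -/
def Dom : Set Pt := Set.univ ×ˢ Set.Ioc 0 (2 * π)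

/-- `2π`-periodicity in the `y` variable. -/
def PeriodicY (u : Pt → ℝ) : Prop := ∀ x y, u (x, y + 2 * π) = u (x, y)

/-- The `i`-th horizontal coordinate direction. -/
def ex (i : Fin 3) : Pt := (fun j => if j = i then 1 else 0, 0)

/-- The vertical (periodic) direction. -/
def ey : Pt := (0, 1)

/-- `i`-th partial derivative in the `x` variables. -/
def gradx (u : Pt → ℝ) (p : Pt) (i : Fin 3) : ℝ := fderiv ℝ u p (ex i)

/-- Partial derivative in the `y` variable, `u_y`. -/
def grady (u : Pt → ℝ) (p : Pt) : ℝ := fderiv ℝ u p ey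

/-- `|∇_x u|²`. -/
def gradSqX (u : Pt → ℝ) (p : Pt) : ℝ := ∑ i, (gradx u p i) ^ 2

/-- `|∇_{x,y} u|²`. -/
def gradSq (u : Pt → ℝ) (p : Pt) : ℝ := gradSqX u p + (grady u p) ^ 2

/-- Membership in (a regular repesentative of) `H¹(ℝ³ × 𝕋)`, for real valued functions. -/
structure H1 (u : Pt → ℝ) : Prop where
  periodic : PeriodicY u
  diff : Differentiable ℝ u
  memL2 : IntegrableOn (fun p => (u p) ^ 2) Dom
  memGrad : IntegrableOn (fun p => gradSq u p) Dom
  memL4 : IntegrableOn (fun p => (u p) ^ 4) Dom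

/-- The `L²(ℝ³ × 𝕋)` norm. -/
def l2 (u : Pt → ℝ) : ℝ := Real.sqrt (∫ p in Dom, (u p) ^ 2)

/-- `u ∈ S_Θ`. -/
def inS (Θ : ℝ) (u : Pt → ℝ) : Prop := H1 u ∧ l2 u = Θ

/-- The nonlinear density `u⁴ + 2u²v² + v⁴`. -/
def nonlin (u v : Pt → ℝ) (p : Pt) : ℝ :=
  (u p) ^ 4 + 2 * (u p) ^ 2 * (v p) ^ 2 + (v p) ^ 4

/-- The energy functional `I(u,v)`. -/
def energy (u v : Pt → ℝ) : ℝ :=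
  (1 / 2) * (∫ p in Dom, (gradSq u p + gradSq v p))
    - (1 / 4) * ∫ p in Dom, nonlin u v p

/-- The semivirial functional `Q(u,v)`. -/
def svirial (u v : Pt → ℝ) : ℝ :=
  (∫ p in Dom, (gradSqX u p + gradSqX v p))
    - (3 / 4) * ∫ p in Dom, nonlin u v p

/-- The ground-state level `m_Θ`. -/
def mlevel (Θ : ℝ) : ℝ :=
  sInf {c | ∃ u v : Pt → ℝ, inS Θ u ∧ inS Θ v ∧ svirial u v = 0 ∧ energy u v = c}

/-- `(u,v)` is a minimizer of `m_Θ`: it lies in `V_Θ` and attains the infimum. -/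
def isMinimizer (Θ : ℝ) (u v : Pt → ℝ) : Prop :=
  inS Θ u ∧ inS Θ v ∧ svirial u v = 0 ∧ energy u v = mlevel Θ

/-- Smooth, compactly supported (in `x`) test function on the waveguide. -/
def TestFun (φ : Pt → ℝ) : Prop :=
  ContDiff ℝ (⊤ : ℕ∞) φ ∧ PeriodicY φ ∧
    ∃ K : Set (Fin 3 → ℝ), IsCompact K ∧ ∀ p : Pt, p.1 ∉ K → φ p = 0

/-- `u` is a weak solution of `-Δ_{x,y} u + lam u = f` on `ℝ³ × 𝕋`. -/
def WeakSol (lam : ℝ) (u f : Pt → ℝ) : Prop :=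
  ∀ φ : Pt → ℝ, TestFun φ →
    (∫ p in Dom,
        ((∑ i, gradx u p i * gradx φ p i) + grady u p * grady φ p + lam * u p * φ p))
      = ∫ p in Dom, f p * φ p

/-- The mass-preserving rescaling `u^τ(x,y) = τ^{3/2} u(τx, y)`. -/
def scaleX (τ : ℝ) (u : Pt → ℝ) : Pt → ℝ :=
  fun p => τ ^ ((3 : ℝ) / 2) * u (τ • p.1, p.2)

/-- `u` is independent of the `y` variable, i.e. `u_y = 0` (a.e.). -/
def Yindep (u : Pt → ℝ) : Prop := ∀ᵐ p : Pt ∂volume, grady u p = 0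

/-- The functional `J_μ(u,v)`. -/
def Jfun (μ : ℝ) (u v : Pt → ℝ) : ℝ :=
  (1 / 2) * (∫ p in Dom,
      (gradSqX u p + μ * (grady u p) ^ 2 + gradSqX v p + μ * (grady v p) ^ 2))
    - (1 / 4) * ∫ p in Dom, nonlin u v p

/-- The level `m_{1,μ}`. -/
def m1 (μ : ℝ) : ℝ :=
  sInf {c | ∃ u v : Pt → ℝ, inS 1 u ∧ inS 1 v ∧ svirial u v = 0 ∧ Jfun μ u v = c}

/-- `(u,v)` is a minimizer of `m_{1,μ}`. -/
def isMinimizerJ (μ : ℝ) (u v : Pt → ℝ) : Prop :=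
  inS 1 u ∧ inS 1 v ∧ svirial u v = 0 ∧ Jfun μ u v = m1 μ

/-! ### Objects on `ℝ³` -/

abbrev Pt3 : Type := Fin 3 → ℝ

def e3 (i : Fin 3) : Pt3 := fun j => if j = i then 1 else 0

def grad3 (w : Pt3 → ℝ) (x : Pt3) (i : Fin 3) : ℝ := fderiv ℝ w x (e3 i)

def gradSq3 (w : Pt3 → ℝ) (x : Pt3) : ℝ := ∑ i, (grad3 w x i) ^ 2

/-- Membership in (a regular representative of) `H¹(ℝ³)`. -/
structure H1R3 (w : Pt3 → ℝ) : Prop where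
  diff : Differentiable ℝ w
  memL2 : Integrable (fun x => (w x) ^ 2)
  memGrad : Integrable (fun x => gradSq3 w x)
  memL4 : Integrable (fun x => (w x) ^ 4)

/-- The `L²(ℝ³)` norm. -/
def l2R3 (w : Pt3 → ℝ) : ℝ := Real.sqrt (∫ x, (w x) ^ 2)

def nonlin3 (u v : Pt3 → ℝ) (x : Pt3) : ℝ :=
  (u x) ^ 4 + 2 * (u x) ^ 2 * (v x) ^ 2 + (v x) ^ 4

/-- The limit energy `Î(u,v)` on `ℝ³`. -/
def Ihat (u v : Pt3 → ℝ) : ℝ :=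
  (1 / 2) * (∫ x, (gradSq3 u x + gradSq3 v x)) - (1 / 4) * ∫ x, nonlin3 u v x

/-- The virial `Q̂(u,v)` on `ℝ³`. -/
def Qhat (u v : Pt3 → ℝ) : ℝ :=
  (∫ x, (gradSq3 u x + gradSq3 v x)) - (3 / 4) * ∫ x, nonlin3 u v x

/-- The ground-state energy `m̂_ρ` on `ℝ³`. -/
def mhat (ρ : ℝ) : ℝ :=
  sInf {c | ∃ u v : Pt3 → ℝ, H1R3 u ∧ H1R3 v ∧ l2R3 u = ρ ∧ l2R3 v = ρ ∧
    Qhat u v = 0 ∧ Ihat u v = c}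


/-! ### One-dimensional estimates -/

lemma enorm_le_add_lintegral_enorm_deriv {h h' : ℝ → ℝ} (hd : ∀ τ, HasDerivAt h (h' τ) τ)
    {I : Set ℝ} (hI : I.OrdConnected) {a x : ℝ} (ha : a ∈ I) (hx : x ∈ I) :
    ‖h x‖ₑ ≤ ‖h a‖ₑ + ∫⁻ τ in I, ‖h' τ‖ₑ := by
  by_cases hfin : ∫⁻ τ in I, ‖h' τ‖ₑ = ⊤
  · simp [hfin]
  have hmeas : Measurable h' := by
    have : h' = deriv h := funext fun τ => (hd τ).deriv.symm
    rw [this]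
    exact measurable_deriv h
  have hint : IntegrableOn h' I := ⟨hmeas.aestronglyMeasurable, lt_top_iff_ne_top.2 hfin⟩
  have hsub : Set.uIcc a x ⊆ I := hI.uIcc_subset ha hx
  have hint' : IntervalIntegrable h' volume a x := (hint.mono_set hsub).intervalIntegrable
  have hftc := intervalIntegral.integral_eq_sub_of_hasDerivAt (fun τ _ => hd τ) hint'
  have hdiff : ‖h x - h a‖ₑ ≤ ∫⁻ τ in I, ‖h' τ‖ₑ := by
    rw [← hftc]
    calc ‖∫ y in a..x, h' y‖ₑ = ‖∫ y in Set.uIoc a x, h' y‖ₑ := by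
          rw [← enorm_norm, intervalIntegral.norm_intervalIntegral_eq, enorm_norm]
      _ ≤ ∫⁻ y in Set.uIoc a x, ‖h' y‖ₑ := enorm_integral_le_lintegral_enorm _
      _ ≤ ∫⁻ τ in I, ‖h' τ‖ₑ :=
          lintegral_mono_set (Set.uIoc_subset_uIcc.trans hsub)
  calc ‖h x‖ₑ = ‖h a + (h x - h a)‖ₑ := by congr 1; ring
    _ ≤ ‖h a‖ₑ + ‖h x - h a‖ₑ := enorm_add_le _ _
    _ ≤ _ := by gcongr

lemma enorm_mul_cube {t : ℝ} (ht : 0 ≤ t) (z : ℝ) :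
    ‖t * z ^ 3‖ₑ = ENNReal.ofReal (t * |z| ^ 3) := by
  rw [Real.enorm_eq_ofReal_abs, abs_mul, abs_of_nonneg ht, abs_pow]

lemma three_mul_le {s : ℝ} (hs : 0 < s) (t a b : ℝ) :
    |t * (3 * a ^ 2 * b)| ≤ 3 / 2 * (s * a ^ 4) + 3 * t ^ 2 * b ^ 2 / (2 * s) := by
  have key : ∀ c : ℝ, c ^ 2 = (t * b) ^ 2 →
      3 * a ^ 2 * c ≤ 3 / 2 * (s * a ^ 4) + 3 * t ^ 2 * b ^ 2 / (2 * s) := by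
    intro c hc
    have h : 3 / 2 * (s * a ^ 4) + 3 * t ^ 2 * b ^ 2 / (2 * s) - 3 * a ^ 2 * c
        = 3 * (s * a ^ 2 - c) ^ 2 / (2 * s) := by
      have : 3 * t ^ 2 * b ^ 2 = 3 * c ^ 2 := by rw [hc]; ring
      rw [this]
      field_simp
      ring
    have : 0 ≤ 3 * (s * a ^ 2 - c) ^ 2 / (2 * s) := by positivity
    linarith
  rw [abs_le]
  have h1 := key (t * b) rfl
  have h2 := key (-(t * b)) (by ring)
  constructor <;> nlinarith

lemma cube_le_lintegral_line {g g' F : ℝ → ℝ} (hd : ∀ τ, HasDerivAt g (g' τ) τ) {s t : ℝ}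
    (hs : 0 < s) (ht : 0 < t)
    (hF : ∀ τ, 2 * s * (g τ) ^ 4 + 3 * t ^ 2 * (g' τ) ^ 2 / (2 * s) ≤ F τ) (x : ℝ) :
    ENNReal.ofReal (t * |g x| ^ 3) ≤ ∫⁻ τ, ENNReal.ofReal (F τ) := by
  by_cases hfin : ∫⁻ τ, ENNReal.ofReal (F τ) = ⊤
  · simp [hfin]
  have hder : ∀ τ, HasDerivAt (fun τ => t * (g τ) ^ 3) (t * (3 * (g τ) ^ 2 * g' τ)) τ := by
    intro τ
    simpa using ((hd τ).fun_pow 3).const_mul t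
  have hle : ∫⁻ τ, ‖t * (3 * (g τ) ^ 2 * g' τ)‖ₑ ≤ ∫⁻ τ, ENNReal.ofReal (F τ) := by
    refine lintegral_mono fun τ => ?_
    rw [Real.enorm_eq_ofReal_abs]
    refine ENNReal.ofReal_le_ofReal ((three_mul_le hs t _ _).trans (le_trans ?_ (hF τ)))
    have : 0 ≤ s * (g τ) ^ 4 := by positivity
    linarith
  refine ENNReal.le_of_forall_pos_le_add fun ε hε _ => ?_
  obtain ⟨a, ha⟩ : ∃ a, t * |g a| ^ 3 ≤ ε := by
    by_contra! hcon
    set δ : ℝ := min 1 (ε / t) with hδ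
    have hε' : (0 : ℝ) < ε := hε
    have hδ0 : 0 < δ := lt_min one_pos (div_pos hε' ht)
    have hδle : t * δ ^ 3 ≤ ε := by
      have h1 : δ ^ 3 ≤ δ := pow_le_of_le_one hδ0.le (min_le_left _ _) (by norm_num)
      calc t * δ ^ 3 ≤ t * (ε / t) := by
            gcongr
            exact h1.trans (min_le_right _ _)
        _ = ε := by field_simp
    have hg : ∀ a, δ ≤ |g a| := by
      intro a
      by_contra! hlt
      have : t * |g a| ^ 3 ≤ t * δ ^ 3 := by gcongr
      linarith [hcon a]
    apply hfin
    rw [eq_top_iff]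
    calc (⊤ : ENNReal) = ∫⁻ _ : ℝ, ENNReal.ofReal (2 * s * δ ^ 4) := by
          rw [lintegral_const, Real.volume_univ, ENNReal.mul_top]
          simp only [ne_eq, ENNReal.ofReal_eq_zero, not_le]
          positivity
      _ ≤ _ := by
          refine lintegral_mono fun τ => ENNReal.ofReal_le_ofReal (le_trans ?_ (hF τ))
          have h1 : δ ^ 4 ≤ (g τ) ^ 4 := by
            rw [← (by decide : Even 4).pow_abs (g τ)]
            exact pow_le_pow_left₀ hδ0.le (hg τ) 4
          have h2 : 0 ≤ 3 * t ^ 2 * (g' τ) ^ 2 / (2 * s) := by positivity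
          have h3 : 2 * s * δ ^ 4 ≤ 2 * s * (g τ) ^ 4 := by gcongr
          linarith
  have h := enorm_le_add_lintegral_enorm_deriv hder Set.ordConnected_univ
    (Set.mem_univ a) (Set.mem_univ x)
  rw [Measure.restrict_univ, enorm_mul_cube ht.le, enorm_mul_cube ht.le] at h
  refine h.trans ?_
  rw [add_comm]
  gcongr
  rw [← ENNReal.ofReal_coe_nnreal]
  exact ENNReal.ofReal_le_ofReal ha

lemma cube_le_lintegral_period {g g' F : ℝ → ℝ} (hd : ∀ τ, HasDerivAt g (g' τ) τ) {s : ℝ}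
    (hs : 0 < s)
    (hF : ∀ τ, 2 * s * (g τ) ^ 4 + 3 * (g' τ) ^ 2 / (2 * s) + (g τ) ^ 2 / (2 * s) ≤ F τ)
    {x : ℝ} (hx : x ∈ Set.Ioc 0 (2 * π)) :
    ENNReal.ofReal (|g x| ^ 3) ≤ ∫⁻ τ in Set.Ioc 0 (2 * π), ENNReal.ofReal (F τ) := by
  have hder : ∀ τ, HasDerivAt (fun τ => (g τ) ^ 3) (3 * (g τ) ^ 2 * g' τ) τ := by
    intro τ
    simpa using (hd τ).fun_pow 3
  have hcont : Continuous g := continuous_iff_continuousAt.2 fun τ => (hd τ).continuousAt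
  have hvol : volume (Set.Ioc 0 (2 * π)) = ENNReal.ofReal (2 * π) := by simp
  have hvol1 : 1 ≤ volume (Set.Ioc 0 (2 * π)) := by
    rw [hvol, ENNReal.one_le_ofReal]
    linarith [pi_gt_three]
  have hmeas : Measurable fun τ => ENNReal.ofReal (|g τ| ^ 3) :=
    ((hcont.abs.pow 3).measurable).ennreal_ofReal
  obtain ⟨a, haI, ha⟩ := exists_le_setLAverage (μ := volume) (s := Set.Ioc 0 (2 * π))
    (f := fun τ => ENNReal.ofReal (|g τ| ^ 3))
    (zero_lt_one.trans_le hvol1).ne' (hvol ▸ ENNReal.ofReal_ne_top) hmeas.aemeasurable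
  rw [setLAverage_eq] at ha
  have ha' : ENNReal.ofReal (|g a| ^ 3)
      ≤ ∫⁻ τ in Set.Ioc 0 (2 * π), ENNReal.ofReal (|g τ| ^ 3) :=
    ha.trans (ENNReal.div_le_of_le_mul (le_mul_of_one_le_right' hvol1))
  have h := enorm_le_add_lintegral_enorm_deriv hder Set.ordConnected_Ioc haI hx
  simp only [Real.enorm_eq_ofReal_abs, abs_pow] at h
  refine h.trans ((add_le_add_left ha' _).trans ?_)
  rw [← lintegral_add_left hmeas]
  refine lintegral_mono fun τ => ?_
  rw [← ENNReal.ofReal_add (by positivity) (by positivity)]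
  refine ENNReal.ofReal_le_ofReal (le_trans ?_ (hF τ))
  have h1 := three_mul_le hs 1 (g τ) (g' τ)
  have h2 : |g τ| ^ 3 ≤ s * (g τ) ^ 4 / 2 + (g τ) ^ 2 / (2 * s) := by
    have e : s * (g τ) ^ 4 / 2 + (g τ) ^ 2 / (2 * s) - |g τ| ^ 3
        = |g τ| ^ 2 * (s * |g τ| - 1) ^ 2 / (2 * s) := by
      rw [← (by decide : Even 4).pow_abs (g τ), ← sq_abs (g τ)]
      field_simp
      ring
    have : 0 ≤ |g τ| ^ 2 * (s * |g τ| - 1) ^ 2 / (2 * s) := by positivity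
    linarith
  simp only [one_mul, one_pow, mul_one] at h1
  linarith

/-! ### The anisotropic Gagliardo–Nirenberg inequality -/

/-- Coordinates on the waveguide with the vertical variable in position `0`. -/
def ofFin4 (x : Fin 4 → ℝ) : Pt := (fun j => x j.succ, x 0)

/-- The measures of the four coordinate directions of `Dom`, in the coordinates `ofFin4`. -/
def dirMeasure : Fin 4 → Measure ℝ :=
  Fin.cons (volume.restrict (Set.Ioc 0 (2 * π))) fun _ => volume

instance (i : Fin 4) : SigmaFinite (dirMeasure i) := by
  refine Fin.cases ?_ (fun j => ?_) i
  · exact inferInstanceAs (SigmaFinite (volume.restrict (Set.Ioc 0 (2 * π))))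
  · exact inferInstanceAs (SigmaFinite (volume : Measure ℝ))

lemma restrict_Dom :
    (volume : Measure Pt).restrict Dom
      = (volume : Measure (Fin 3 → ℝ)).prod (volume.restrict (Set.Ioc 0 (2 * π))) := by
  rw [Dom, Measure.volume_eq_prod, ← Measure.prod_restrict, Measure.restrict_univ]

lemma measurePreserving_ofFin4 :
    MeasurePreserving ofFin4 (Measure.pi dirMeasure) ((volume : Measure Pt).restrict Dom) := by
  rw [restrict_Dom]
  exact Measure.measurePreserving_swap.comp (measurePreserving_piFinSuccAbove dirMeasure 0)

lemma hasDerivAt_ofFin4_update (x : Fin 4 → ℝ) (i : Fin 4) (τ : ℝ) :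
    HasDerivAt (fun τ => ofFin4 (Function.update x i τ)) (ofFin4 (Pi.single i 1)) τ := by
  have h := hasDerivAt_pi.1 (hasDerivAt_update x i τ)
  exact (hasDerivAt_pi.2 fun j : Fin 3 => h j.succ).prodMk (h 0)

lemma ofFin4_single_zero : ofFin4 (Pi.single 0 1) = ey := by
  ext <;> simp [ofFin4, ey]

lemma ofFin4_single_succ (j : Fin 3) : ofFin4 (Pi.single j.succ 1) = ex j := by
  ext k
  · simp [ofFin4, ex, Pi.single_apply]
  · simp [ofFin4, ex, Pi.single_apply, (Fin.succ_ne_zero _).symm]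

lemma hasDerivAt_line {u : Pt → ℝ} (hu : Differentiable ℝ u) (x : Fin 4 → ℝ) (i : Fin 4) (τ : ℝ) :
    HasDerivAt (fun τ => u (ofFin4 (Function.update x i τ)))
      (fderiv ℝ u (ofFin4 (Function.update x i τ)) (ofFin4 (Pi.single i 1))) τ :=
  (hu _).hasFDerivAt.comp_hasDerivAt τ (hasDerivAt_ofFin4_update x i τ)

lemma gradSqX_nonneg (u : Pt → ℝ) (p : Pt) : 0 ≤ gradSqX u p :=
  Finset.sum_nonneg fun _ _ => sq_nonneg _

lemma sq_gradx_le (u : Pt → ℝ) (p : Pt) (j : Fin 3) : (gradx u p j) ^ 2 ≤ gradSqX u p :=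
  Finset.single_le_sum (f := fun i => (gradx u p i) ^ 2) (fun _ _ => sq_nonneg _)
    (Finset.mem_univ j)

lemma measurable_gradSqX (u : Pt → ℝ) : Measurable (gradSqX u) :=
  Finset.measurable_fun_sum _ fun i _ => (measurable_fderiv_apply_const ℝ u (ex i)).pow_const 2

lemma measurable_grady_sq (u : Pt → ℝ) : Measurable fun p => (grady u p) ^ 2 :=
  (measurable_fderiv_apply_const ℝ u ey).pow_const 2

lemma H1.integrable_gradSqX {u : Pt → ℝ} (hu : H1 u) : IntegrableOn (gradSqX u) Dom := by
  refine hu.memGrad.mono' (measurable_gradSqX u).aestronglyMeasurable (.of_forall fun p => ?_)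
  rw [Real.norm_of_nonneg (gradSqX_nonneg u p), gradSq]
  linarith [sq_nonneg (grady u p)]

lemma H1.integrable_grady_sq {u : Pt → ℝ} (hu : H1 u) :
    IntegrableOn (fun p => (grady u p) ^ 2) Dom := by
  refine hu.memGrad.mono' (measurable_grady_sq u).aestronglyMeasurable (.of_forall fun p => ?_)
  rw [Real.norm_of_nonneg (sq_nonneg _), gradSq]
  linarith [gradSqX_nonneg u p]

/-- The density whose line integrals dominate `|u|³`. -/
def lineDensity (s t : ℝ) (u : Pt → ℝ) (p : Pt) : ℝ :=
  2 * s * (u p) ^ 4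
    + (3 * t ^ 2 * gradSqX u p + 3 * (grady u p) ^ 2 + (u p) ^ 2) / (2 * s)

lemma lineDensity_nonneg {s : ℝ} (hs : 0 < s) (t : ℝ) (u : Pt → ℝ) (p : Pt) :
    0 ≤ lineDensity s t u p := by
  have := gradSqX_nonneg u p
  unfold lineDensity
  positivity

lemma H1.measurable_lineDensity {u : Pt → ℝ} (hu : H1 u) (s t : ℝ) :
    Measurable (lineDensity s t u) := by
  have h1 := hu.diff.continuous.measurable
  have h2 := measurable_gradSqX u
  have h3 := measurable_grady_sq u
  unfold lineDensity
  fun_prop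

lemma H1.integrable_lineDensity {u : Pt → ℝ} (hu : H1 u) (s t : ℝ) :
    IntegrableOn (lineDensity s t u) Dom :=
  (hu.memL4.const_mul _).add
    ((((hu.integrable_gradSqX.const_mul _).add (hu.integrable_grady_sq.const_mul _)).add
      hu.memL2).div_const _)

lemma H1.integral_lineDensity {u : Pt → ℝ} (hu : H1 u) (s t : ℝ) :
    ∫ p in Dom, lineDensity s t u p = 2 * s * (∫ p in Dom, (u p) ^ 4)
      + (3 * t ^ 2 * (∫ p in Dom, gradSqX u p) + 3 * (∫ p in Dom, (grady u p) ^ 2)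
        + ∫ p in Dom, (u p) ^ 2) / (2 * s) := by
  have i1 := hu.integrable_gradSqX.const_mul (3 * t ^ 2)
  have i2 := hu.integrable_grady_sq.const_mul 3
  have i3 : IntegrableOn
      (fun p => 3 * t ^ 2 * gradSqX u p + 3 * (grady u p) ^ 2) Dom := i1.add i2
  have i4 : IntegrableOn
      (fun p => 3 * t ^ 2 * gradSqX u p + 3 * (grady u p) ^ 2 + (u p) ^ 2) Dom := i3.add hu.memL2
  unfold lineDensity
  rw [integral_add (hu.memL4.const_mul _) (i4.div_const _),
    integral_div, integral_const_mul, integral_add i3 hu.memL2, integral_add i1 i2,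
    integral_const_mul, integral_const_mul]

lemma H1.cube_le_line_zero {u : Pt → ℝ} (hu : H1 u) {s : ℝ} (hs : 0 < s) (t : ℝ)
    {x : Fin 4 → ℝ} (hx : x 0 ∈ Set.Ioc 0 (2 * π)) :
    ENNReal.ofReal (|u (ofFin4 x)| ^ 3)
      ≤ ∫⁻ τ, ENNReal.ofReal (lineDensity s t u (ofFin4 (Function.update x 0 τ)))
        ∂dirMeasure 0 := by
  have h := cube_le_lintegral_period (hasDerivAt_line hu.diff x 0) hs
    (F := fun τ => lineDensity s t u (ofFin4 (Function.update x 0 τ))) (fun τ => ?_) hx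
  · rwa [Function.update_eq_self] at h
  · have : 0 ≤ 3 * t ^ 2 * gradSqX u (ofFin4 (Function.update x 0 τ)) / (2 * s) := by
      have := gradSqX_nonneg u (ofFin4 (Function.update x 0 τ))
      positivity
    rw [ofFin4_single_zero, lineDensity, add_div, add_div, ← grady]
    linarith

lemma H1.cube_le_line_succ {u : Pt → ℝ} (hu : H1 u) {s t : ℝ} (hs : 0 < s) (ht : 0 < t)
    (x : Fin 4 → ℝ) (j : Fin 3) :
    ENNReal.ofReal (t * |u (ofFin4 x)| ^ 3)
      ≤ ∫⁻ τ, ENNReal.ofReal (lineDensity s t u (ofFin4 (Function.update x j.succ τ)))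
        ∂dirMeasure j.succ := by
  have h := cube_le_lintegral_line (hasDerivAt_line hu.diff x j.succ) hs ht
    (F := fun τ => lineDensity s t u (ofFin4 (Function.update x j.succ τ))) (fun τ => ?_)
    (x j.succ)
  · rwa [Function.update_eq_self] at h
  · set p := ofFin4 (Function.update x j.succ τ)
    have h1 : 3 * t ^ 2 * (gradx u p j) ^ 2 / (2 * s) ≤ 3 * t ^ 2 * gradSqX u p / (2 * s) := by
      gcongr
      exact sq_gradx_le u p j
    have h2 : 0 ≤ 3 * (grady u p) ^ 2 / (2 * s) := by positivity
    have h3 : 0 ≤ (u p) ^ 2 / (2 * s) := by positivity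
    rw [ofFin4_single_succ, lineDensity, add_div, add_div, ← gradx]
    linarith

lemma ofReal_cube_rpow_third {z : ℝ} (hz : 0 ≤ z) :
    ENNReal.ofReal (z ^ 3) ^ (1 / 3 : ℝ) = ENNReal.ofReal z := by
  rw [ENNReal.ofReal_rpow_of_nonneg (by positivity) (by norm_num), ← Real.rpow_natCast,
    ← Real.rpow_mul hz]
  norm_num

lemma H1.quartic_lintegral_le {u : Pt → ℝ} (hu : H1 u) {s r : ℝ} (hs : 0 < s) (hr : 0 < r) :
    ∫⁻ p in Dom, ENNReal.ofReal (r ^ 3 * (u p) ^ 4)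
      ≤ (∫⁻ p in Dom, ENNReal.ofReal (lineDensity s (r ^ 3) u p)) ^ (4 / 3 : ℝ) := by
  have hcont := hu.diff.continuous
  have hmu : Measurable fun p => ENNReal.ofReal (r ^ 3 * (u p) ^ 4) :=
    ((hcont.pow 4).const_smul (r ^ 3)).measurable.ennreal_ofReal
  have hmd : Measurable fun p => ENNReal.ofReal (lineDensity s (r ^ 3) u p) :=
    (hu.measurable_lineDensity s (r ^ 3)).ennreal_ofReal
  have hmp := measurePreserving_ofFin4
  rw [← hmp.lintegral_comp hmu, ← hmp.lintegral_comp hmd]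
  have hconj : Real.HolderConjugate (Fintype.card (Fin 4)) (4 / 3) := by
    rw [Real.holderConjugate_iff]
    norm_num
  refine le_trans ?_ (lintegral_prod_lintegral_pow_le dirMeasure hconj (hmd.comp hmp.measurable))
  refine lintegral_mono_ae ?_
  have hmem : ∀ᵐ τ ∂dirMeasure 0, τ ∈ Set.Ioc 0 (2 * π) := ae_restrict_mem measurableSet_Ioc
  filter_upwards [(Measure.tendsto_eval_ae_ae (μ := dirMeasure) (i := 0)).eventually hmem]
    with x hx
  have hexp : (1 : ℝ) / ((Fintype.card (Fin 4) : ℝ) - 1) = 1 / 3 := by norm_num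
  rw [hexp, Fin.prod_univ_succ]
  set a := |u (ofFin4 x)| with ha
  have ha0 : 0 ≤ a := abs_nonneg _
  calc ENNReal.ofReal (r ^ 3 * (u (ofFin4 x)) ^ 4)
      = ENNReal.ofReal a * ∏ _j : Fin 3, ENNReal.ofReal (r * a) := by
        rw [Finset.prod_const, Finset.card_univ, Fintype.card_fin,
          ← ENNReal.ofReal_pow (by positivity), ← ENNReal.ofReal_mul ha0,
          ← (by decide : Even 4).pow_abs (u (ofFin4 x)), ← ha]
        congr 1
        ring
    _ ≤ _ := by
        gcongr with j
        · rw [← ofReal_cube_rpow_third ha0]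
          exact ENNReal.rpow_le_rpow (hu.cube_le_line_zero hs _ hx) (by norm_num)
        · rw [← ofReal_cube_rpow_third (by positivity : 0 ≤ r * a), mul_pow]
          exact ENNReal.rpow_le_rpow (hu.cube_le_line_succ hs (by positivity) x j) (by norm_num)

lemma H1.quartic_integral_le {u : Pt → ℝ} (hu : H1 u) {s t : ℝ} (hs : 0 < s) (ht : 0 < t) :
    (t * ∫ p in Dom, (u p) ^ 4) ^ 3 ≤ (∫ p in Dom, lineDensity s t u p) ^ 4 := by
  obtain ⟨r, hr, rfl⟩ : ∃ r : ℝ, 0 < r ∧ r ^ 3 = t :=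
    ⟨t ^ (1 / 3 : ℝ), by positivity, by
      rw [← Real.rpow_natCast, ← Real.rpow_mul ht.le]; norm_num⟩
  have h := hu.quartic_lintegral_le hs hr
  have hD : 0 ≤ ∫ p in Dom, lineDensity s (r ^ 3) u p :=
    integral_nonneg fun p => lineDensity_nonneg hs _ u p
  have hN : 0 ≤ ∫ p in Dom, (u p) ^ 4 := integral_nonneg fun p => by positivity
  rw [← ofReal_integral_eq_lintegral_ofReal (hu.memL4.const_mul _)
      (.of_forall fun p => by positivity),
    ← ofReal_integral_eq_lintegral_ofReal (hu.integrable_lineDensity s _)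
      (.of_forall fun p => lineDensity_nonneg hs _ u p),
    ENNReal.ofReal_rpow_of_nonneg hD (by norm_num),
    ENNReal.ofReal_le_ofReal_iff (by positivity), integral_const_mul] at h
  calc (r ^ 3 * ∫ p in Dom, (u p) ^ 4) ^ 3
      ≤ ((∫ p in Dom, lineDensity s (r ^ 3) u p) ^ (4 / 3 : ℝ)) ^ 3 :=
        pow_le_pow_left₀ (by positivity) h 3
    _ = _ := by
        rw [← Real.rpow_natCast, ← Real.rpow_mul hD, ← Real.rpow_natCast]
        norm_num

/-- The Gagliardo–Nirenberg inequality on the waveguide, with a free parameter `t` weighting the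
horizontal derivatives. -/
lemma H1.gagliardo_nirenberg {u : Pt → ℝ} (hu : H1 u) {t : ℝ} (ht : 0 < t) :
    t ^ 3 * ∫ p in Dom, (u p) ^ 4
      ≤ (2 + (3 * t ^ 2 * (∫ p in Dom, gradSqX u p) + 3 * (∫ p in Dom, (grady u p) ^ 2)
        + ∫ p in Dom, (u p) ^ 2) / 2) ^ 4 := by
  have hN : 0 ≤ ∫ p in Dom, (u p) ^ 4 := integral_nonneg fun p => by positivity
  rcases hN.eq_or_lt with h0 | hpos
  · rw [← h0, mul_zero]
    positivity
  obtain ⟨n, hn, hn2⟩ : ∃ n : ℝ, 0 < n ∧ n ^ 2 = ∫ p in Dom, (u p) ^ 4 :=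
    ⟨√(∫ p in Dom, (u p) ^ 4), Real.sqrt_pos.2 hpos, Real.sq_sqrt hN⟩
  have h := hu.quartic_integral_le (inv_pos.2 hn) ht
  rw [hu.integral_lineDensity, ← hn2] at h
  rw [← hn2]
  set B := 3 * t ^ 2 * (∫ p in Dom, gradSqX u p) + 3 * (∫ p in Dom, (grady u p) ^ 2)
        + ∫ p in Dom, (u p) ^ 2
  have e1 : 2 * n⁻¹ * n ^ 2 + B / (2 * n⁻¹) = n * (2 + B / 2) := by
    field_simp
  rw [e1] at h
  have hn4 : 0 < n ^ 4 := by positivity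
  refine le_of_mul_le_mul_left ?_ hn4
  calc n ^ 4 * (t ^ 3 * n ^ 2) = (t * n ^ 2) ^ 3 := by ring
    _ ≤ (n * (2 + B / 2)) ^ 4 := h
    _ = _ := by ring

/-! ### Lower bound for the energy -/

/-- Horizontal kinetic energy `∫ |∇_x u|²`. -/
def kinX (u : Pt → ℝ) : ℝ := ∫ p in Dom, gradSqX u p

/-- Vertical kinetic energy `∫ u_y²`. -/
def kinY (u : Pt → ℝ) : ℝ := ∫ p in Dom, (grady u p) ^ 2

/-- The quartic integral `∫ u⁴`. -/
def quartic (u : Pt → ℝ) : ℝ := ∫ p in Dom, (u p) ^ 4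

lemma kinX_nonneg (u : Pt → ℝ) : 0 ≤ kinX u := integral_nonneg fun p => gradSqX_nonneg u p

lemma kinY_nonneg (u : Pt → ℝ) : 0 ≤ kinY u := integral_nonneg fun _ => sq_nonneg _

lemma quartic_nonneg (u : Pt → ℝ) : 0 ≤ quartic u :=
  integral_nonneg fun p => (by positivity : 0 ≤ (u p) ^ 4)

lemma inS.integral_sq {Θ : ℝ} {u : Pt → ℝ} (hu : inS Θ u) : ∫ p in Dom, (u p) ^ 2 = Θ ^ 2 := by
  rw [← hu.2, l2, Real.sq_sqrt (integral_nonneg fun p => sq_nonneg _)]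

lemma inS.quartic_pos {Θ : ℝ} (hΘ : 0 < Θ) {u : Pt → ℝ} (hu : inS Θ u) : 0 < quartic u := by
  refine (quartic_nonneg u).lt_of_ne' fun h0 => ?_
  have hae := (setIntegral_eq_zero_iff_of_nonneg_ae
    (.of_forall fun p => (by positivity : 0 ≤ (u p) ^ 4)) hu.1.memL4).1 h0
  have h2 : ∫ p in Dom, (u p) ^ 2 = 0 := by
    refine integral_eq_zero_of_ae ?_
    filter_upwards [hae] with p hp
    have : u p = 0 := by simpa using hp
    simp [this]
  rw [hu.integral_sq] at h2
  exact hΘ.ne' (by simpa using h2)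

lemma integrable_nonlin {u v : Pt → ℝ} (hu : H1 u) (hv : H1 v) : IntegrableOn (nonlin u v) Dom := by
  have hm : Measurable (nonlin u v) := by
    have h1 := hu.diff.continuous.measurable
    have h2 := hv.diff.continuous.measurable
    unfold nonlin
    fun_prop
  refine ((hu.memL4.add hv.memL4).const_mul 2).mono' hm.aestronglyMeasurable
    (.of_forall fun p => ?_)
  have h0 : 0 ≤ nonlin u v p := by unfold nonlin; positivity
  rw [Real.norm_of_nonneg h0]
  simp only [nonlin, Pi.add_apply]
  nlinarith [sq_nonneg ((u p) ^ 2 - (v p) ^ 2)]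

lemma integral_nonlin_le {u v : Pt → ℝ} (hu : H1 u) (hv : H1 v) :
    ∫ p in Dom, nonlin u v p ≤ 2 * (quartic u + quartic v) := by
  rw [quartic, quartic, ← integral_add hu.memL4 hv.memL4, ← integral_const_mul]
  refine integral_mono (integrable_nonlin hu hv) ((hu.memL4.add hv.memL4).const_mul 2) fun p => ?_
  simp only [nonlin]
  nlinarith [sq_nonneg ((u p) ^ 2 - (v p) ^ 2)]

lemma quartic_le_integral_nonlin {u v : Pt → ℝ} (hu : H1 u) (hv : H1 v) :
    quartic u ≤ ∫ p in Dom, nonlin u v p := by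
  refine integral_mono hu.memL4 (integrable_nonlin hu hv) fun p => ?_
  have : 0 ≤ 2 * (u p) ^ 2 * (v p) ^ 2 + (v p) ^ 4 := by positivity
  simp only [nonlin]
  linarith

lemma svirial_eq {u v : Pt → ℝ} (hu : H1 u) (hv : H1 v) :
    svirial u v = kinX u + kinX v - (3 / 4) * ∫ p in Dom, nonlin u v p := by
  rw [svirial, integral_add hu.integrable_gradSqX hv.integrable_gradSqX, kinX, kinX]

lemma H1.integral_gradSq {u : Pt → ℝ} (hu : H1 u) :
    ∫ p in Dom, gradSq u p = kinX u + kinY u :=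
  integral_add hu.integrable_gradSqX hu.integrable_grady_sq

lemma energy_eq_of_svirial_eq_zero {u v : Pt → ℝ} (hu : H1 u) (hv : H1 v)
    (hQ : svirial u v = 0) :
    energy u v = (kinX u + kinX v) / 6 + (kinY u + kinY v) / 2 := by
  rw [svirial_eq hu hv] at hQ
  rw [energy, integral_add hu.memGrad hv.memGrad, hu.integral_gradSq, hv.integral_gradSq]
  linarith

lemma one_le_of_svirial_eq_zero {Θ : ℝ} (hΘ : 0 < Θ) {u v : Pt → ℝ} (hu : inS Θ u)
    (hv : inS Θ v) (hQ : svirial u v = 0) :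
    1 ≤ 3 * √(kinX u + kinX v) * (2 + (3 + 3 * (kinY u + kinY v) + Θ ^ 2) / 2) ^ 4 := by
  rw [svirial_eq hu.1 hv.1] at hQ
  have hX : 0 < kinX u + kinX v := by
    have := hu.quartic_pos hΘ
    have := quartic_le_integral_nonlin hu.1 hv.1
    linarith
  set q := √(kinX u + kinX v) with hq
  have hq0 : 0 < q := Real.sqrt_pos.2 hX
  have hq2 : q ^ 2 = kinX u + kinX v := Real.sq_sqrt hX.le
  set K := 2 + (3 + 3 * (kinY u + kinY v) + Θ ^ 2) / 2 with hK
  have key : ∀ w : Pt → ℝ, inS Θ w → kinX w ≤ q ^ 2 → kinY w ≤ kinY u + kinY v →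
      quartic w ≤ q ^ 3 * K ^ 4 := by
    intro w hw hwX hwY
    have h := hw.1.gagliardo_nirenberg (inv_pos.2 hq0)
    rw [hw.integral_sq, ← kinX, ← kinY, ← quartic] at h
    have hX1 : q⁻¹ ^ 2 * kinX w ≤ 1 := by
      rw [inv_pow]
      exact inv_mul_le_one_of_le₀ hwX (by positivity)
    have hX0 := kinX_nonneg w
    have hY0 := kinY_nonneg w
    have hle : (2 + (3 * q⁻¹ ^ 2 * kinX w + 3 * kinY w + Θ ^ 2) / 2) ^ 4 ≤ K ^ 4 := by
      refine pow_le_pow_left₀ (by positivity) ?_ 4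
      linarith
    have h' := h.trans hle
    rwa [inv_pow, inv_mul_le_iff₀ (by positivity)] at h'
  have h1 := key u hu (by linarith [kinX_nonneg v]) (by linarith [kinY_nonneg v])
  have h2 := key v hv (by linarith [kinX_nonneg u]) (by linarith [kinY_nonneg u])
  have h3 := integral_nonlin_le hu.1 hv.1
  have h4 : q ^ 2 * 1 ≤ q ^ 2 * (3 * q * K ^ 4) := by
    have e : q ^ 2 * (3 * q * K ^ 4) = 3 * (q ^ 3 * K ^ 4) := by ring
    linarith
  exact le_of_mul_le_mul_left h4 (by positivity)

lemma exists_pos_le_energy {Θ : ℝ} (hΘ : 0 < Θ) :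
    ∃ c : ℝ, 0 < c ∧ ∀ u v : Pt → ℝ, inS Θ u → inS Θ v → svirial u v = 0 → c ≤ energy u v := by
  set K := 2 + (9 + Θ ^ 2) / 2 with hK
  have hK0 : 0 < K := by positivity
  refine ⟨min 1 ((1 / (3 * K ^ 4)) ^ 2 / 6), by positivity, fun u v hu hv hQ => ?_⟩
  rw [energy_eq_of_svirial_eq_zero hu.1 hv.1 hQ]
  have hX := add_nonneg (kinX_nonneg u) (kinX_nonneg v)
  have hY := add_nonneg (kinY_nonneg u) (kinY_nonneg v)
  have h := one_le_of_svirial_eq_zero hΘ hu hv hQ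
  set X := kinX u + kinX v
  set Y := kinY u + kinY v
  by_cases hY2 : 2 ≤ Y
  · exact (min_le_left _ _).trans (by linarith)
  refine (min_le_right _ _).trans ?_
  have hle : (2 + (3 + 3 * Y + Θ ^ 2) / 2) ^ 4 ≤ K ^ 4 :=
    pow_le_pow_left₀ (by positivity) (by rw [hK]; linarith) 4
  have h1 : 1 ≤ √X * (3 * K ^ 4) := by
    calc 1 ≤ 3 * √X * (2 + (3 + 3 * Y + Θ ^ 2) / 2) ^ 4 := h
      _ ≤ 3 * √X * K ^ 4 := by gcongr
      _ = _ := by ring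
  have h2 : 1 / (3 * K ^ 4) ≤ √X := (div_le_iff₀ (by positivity)).2 h1
  have h3 : (1 / (3 * K ^ 4)) ^ 2 ≤ X := by
    rw [← Real.sq_sqrt hX]
    exact pow_le_pow_left₀ (by positivity) h2 2
  linarith

/-! ### Nonemptiness of the constraint set -/

lemma integral_Dom_fst (f : Pt3 → ℝ) : ∫ p in Dom, f p.1 = 2 * π * ∫ x, f x := by
  rw [restrict_Dom, integral_fun_fst, smul_eq_mul]
  congr 1
  simp [Measure.real, ENNReal.toReal_ofReal pi_pos.le]

lemma integrableOn_Dom_fst {f : Pt3 → ℝ} (hf : Integrable f) :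
    IntegrableOn (fun p : Pt => f p.1) Dom := by
  rw [IntegrableOn, restrict_Dom]
  exact hf.comp_fst _

/-- The amplitude-`a`, frequency-`b` rescaling of a profile on `ℝ³`, extended constantly in `y`. -/
def dilate (a b : ℝ) (φ : Pt3 → ℝ) (p : Pt) : ℝ := a * φ (b • p.1)

lemma hasFDerivAt_dilate {φ : Pt3 → ℝ} (hφ : Differentiable ℝ φ) (a b : ℝ) (p : Pt) :
    HasFDerivAt (dilate a b φ)
      (a • (fderiv ℝ φ (b • p.1)).comp (b • ContinuousLinearMap.fst ℝ Pt3 ℝ)) p :=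
  ((hφ _).hasFDerivAt.comp p (hasFDerivAt_fst.const_smul b)).const_mul a

lemma gradSqX_dilate {φ : Pt3 → ℝ} (hφ : Differentiable ℝ φ) (a b : ℝ) (p : Pt) :
    gradSqX (dilate a b φ) p = a ^ 2 * b ^ 2 * gradSq3 φ (b • p.1) := by
  rw [gradSqX, gradSq3, Finset.mul_sum]
  refine Finset.sum_congr rfl fun i _ => ?_
  have : ContinuousLinearMap.fst ℝ Pt3 ℝ (ex i) = e3 i := rfl
  rw [gradx, (hasFDerivAt_dilate hφ a b p).fderiv, grad3]
  simp only [_root_.smul_apply, ContinuousLinearMap.comp_apply, this, map_smul,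
    smul_eq_mul]
  ring

lemma grady_dilate {φ : Pt3 → ℝ} (hφ : Differentiable ℝ φ) (a b : ℝ) (p : Pt) :
    grady (dilate a b φ) p = 0 := by
  have : ContinuousLinearMap.fst ℝ Pt3 ℝ ey = 0 := rfl
  rw [grady, (hasFDerivAt_dilate hφ a b p).fderiv]
  simp [this]

lemma H1R3.dilate {φ : Pt3 → ℝ} (hφ : H1R3 φ) (a : ℝ) {b : ℝ} (hb : b ≠ 0) :
    H1 (dilate a b φ) where
  periodic _ _ := rfl
  diff p := (hasFDerivAt_dilate hφ.diff a b p).differentiableAt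
  memL2 := by
    simp only [Waveguide.dilate, mul_pow]
    exact (integrableOn_Dom_fst (hφ.memL2.comp_smul hb)).const_mul _
  memGrad := by
    simp only [gradSq, gradSqX_dilate hφ.diff, grady_dilate hφ.diff, ne_eq, OfNat.ofNat_ne_zero,
      not_false_eq_true, zero_pow, add_zero]
    exact (integrableOn_Dom_fst (hφ.memGrad.comp_smul hb)).const_mul _
  memL4 := by
    simp only [Waveguide.dilate, mul_pow]
    exact (integrableOn_Dom_fst (hφ.memL4.comp_smul hb)).const_mul _

lemma integral_comp_smul_Pt3 (f : Pt3 → ℝ) {b : ℝ} (hb : 0 < b) :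
    ∫ x, f (b • x) = (∫ x, f x) / b ^ 3 := by
  rw [Measure.integral_comp_smul, Module.finrank_fin_fun, smul_eq_mul,
    abs_of_pos (by positivity), inv_mul_eq_div]

lemma integral_dilate_pow (φ : Pt3 → ℝ) (a : ℝ) {b : ℝ} (hb : 0 < b) (n : ℕ) :
    ∫ p in Dom, (dilate a b φ p) ^ n = a ^ n * (2 * π * ((∫ x, (φ x) ^ n) / b ^ 3)) := by
  simp only [dilate, mul_pow]
  rw [integral_const_mul, integral_Dom_fst fun x => (φ (b • x)) ^ n,
    integral_comp_smul_Pt3 (fun x => (φ x) ^ n) hb]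

lemma kinX_dilate {φ : Pt3 → ℝ} (hφ : Differentiable ℝ φ) (a : ℝ) {b : ℝ} (hb : 0 < b) :
    kinX (dilate a b φ) = a ^ 2 * b ^ 2 * (2 * π * ((∫ x, gradSq3 φ x) / b ^ 3)) := by
  simp only [kinX, gradSqX_dilate hφ]
  rw [integral_const_mul, integral_Dom_fst fun x => gradSq3 φ (b • x),
    integral_comp_smul_Pt3 (gradSq3 φ) hb]

lemma svirial_self {u : Pt → ℝ} (hu : H1 u) : svirial u u = 2 * kinX u - 3 * quartic u := by
  have : ∀ p, nonlin u u p = 4 * (u p) ^ 4 := fun p => by rw [nonlin]; ring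
  rw [svirial_eq hu hu]
  simp only [this]
  rw [integral_const_mul, quartic]
  ring

lemma exists_profile : ∃ φ : Pt3 → ℝ, H1R3 φ ∧ 0 < ∫ x, (φ x) ^ 2 ∧ 0 < ∫ x, gradSq3 φ x ∧
    0 < ∫ x, (φ x) ^ 4 := by
  let φ : ContDiffBump (0 : Pt3) := ⟨1, 2, one_pos, one_lt_two⟩
  have hsmooth : ContDiff ℝ 1 φ := φ.contDiff
  have hcomp : HasCompactSupport φ := φ.hasCompactSupport
  have hcont : Continuous φ := hsmooth.continuous
  have hdiff : Differentiable ℝ φ := hsmooth.differentiable one_ne_zero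
  have hφ0 : φ 0 = 1 := φ.one_of_mem_closedBall (by simp [φ])
  have hgcont : Continuous (gradSq3 φ) := by
    have := hsmooth.continuous_fderiv one_ne_zero
    unfold gradSq3 grad3
    fun_prop
  have hgcomp : HasCompactSupport (gradSq3 φ) :=
    (hcomp.fderiv ℝ).comp_left (g := fun L : Pt3 →L[ℝ] ℝ => ∑ i, (L (e3 i)) ^ 2) (by simp)
  have hpow : ∀ n : ℕ, n ≠ 0 → HasCompactSupport fun x => (φ x) ^ n := fun n hn =>
    hcomp.comp_left (g := fun z : ℝ => z ^ n) (zero_pow hn)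
  have hg0 : ∀ x, 0 ≤ gradSq3 φ x := fun x => Finset.sum_nonneg fun _ _ => sq_nonneg _
  obtain ⟨z, hz⟩ : ∃ z, gradSq3 φ z ≠ 0 := by
    by_contra! h
    have hfd : ∀ x, fderiv ℝ φ x = 0 := by
      intro x
      have hx := (Finset.sum_eq_zero_iff_of_nonneg (fun _ _ => sq_nonneg _)).1 (h x)
      refine ContinuousLinearMap.coe_injective ((Pi.basisFun ℝ (Fin 3)).ext fun i => ?_)
      have hi : fderiv ℝ φ x (e3 i) = 0 := by simpa [grad3] using hx i (Finset.mem_univ i)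
      have he : Pi.basisFun ℝ (Fin 3) i = e3 i := by
        ext j
        simp [e3, Pi.single_apply]
      simpa [he] using hi
    have hconst := is_const_of_fderiv_eq_zero hdiff hfd 0 (fun _ => 3)
    rw [hφ0, φ.zero_of_le_dist] at hconst
    · exact one_ne_zero hconst
    · rw [dist_zero_right, pi_norm_const]
      norm_num [φ]
  refine ⟨φ, ⟨hdiff, (hcont.pow 2).integrable_of_hasCompactSupport (hpow 2 two_ne_zero),
    hgcont.integrable_of_hasCompactSupport hgcomp,
    (hcont.pow 4).integrable_of_hasCompactSupport (hpow 4 four_ne_zero)⟩, ?_, ?_, ?_⟩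
  · exact (hcont.pow 2).integral_pos_of_hasCompactSupport_nonneg_nonzero (hpow 2 two_ne_zero)
      (fun x => sq_nonneg _) (x := 0) (by simp [hφ0])
  · exact hgcont.integral_pos_of_hasCompactSupport_nonneg_nonzero hgcomp hg0 hz
  · exact (hcont.pow 4).integral_pos_of_hasCompactSupport_nonneg_nonzero (hpow 4 four_ne_zero)
      (fun x => (by positivity : 0 ≤ (φ x) ^ 4)) (x := 0) (by simp [hφ0])

lemma exists_inS_svirial_eq_zero {Θ : ℝ} (hΘ : 0 < Θ) :
    ∃ u v : Pt → ℝ, inS Θ u ∧ inS Θ v ∧ svirial u v = 0 := by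
  obtain ⟨φ, hφ, hP, hG, hM⟩ := exists_profile
  set P := ∫ x, (φ x) ^ 2
  set G := ∫ x, gradSq3 φ x
  set M := ∫ x, (φ x) ^ 4
  have hπ := pi_pos
  set b := 4 * π * G * P / (3 * M * Θ ^ 2) with hb
  have hb0 : 0 < b := by positivity
  set a := √(Θ ^ 2 * b ^ 3 / (2 * π * P)) with ha
  have ha2 : a ^ 2 = Θ ^ 2 * b ^ 3 / (2 * π * P) := Real.sq_sqrt (by positivity)
  have hH1 := hφ.dilate a hb0.ne'
  have hS : inS Θ (dilate a b φ) := by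
    refine ⟨hH1, ?_⟩
    rw [l2, integral_dilate_pow φ a hb0, ha2, Real.sqrt_eq_iff_mul_self_eq_of_pos hΘ]
    change _ = Θ ^ 2 * b ^ 3 / (2 * π * P) * (2 * π * (P / b ^ 3))
    field_simp
  refine ⟨_, _, hS, hS, ?_⟩
  rw [svirial_self hH1, kinX_dilate hφ.diff a hb0, quartic, integral_dilate_pow φ a hb0]
  change 2 * (a ^ 2 * b ^ 2 * (2 * π * (G / b ^ 3))) - 3 * (a ^ 4 * (2 * π * (M / b ^ 3))) = 0
  have hbal : 2 * b ^ 2 * G = 3 * a ^ 2 * M := by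
    rw [ha2]
    have : b * (3 * M * Θ ^ 2) = 4 * π * G * P := by rw [hb]; field_simp
    field_simp
    linear_combination -this
  linear_combination (a ^ 2 * (2 * π) / b ^ 3) * hbal

/-- for every `Θ > 0`, `V_Θ` is nonempty, `I` is bounded below on `V_Θ`,
and `0 < m_Θ`. -/
theorem mlevel_pos_and_finite (Θ : ℝ) (hΘ : 0 < Θ) :
    (∃ u v : Pt → ℝ, inS Θ u ∧ inS Θ v ∧ svirial u v = 0) ∧
    (∃ b : ℝ, ∀ u v : Pt → ℝ, inS Θ u → inS Θ v → svirial u v = 0 → b ≤ energy u v) ∧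
    0 < mlevel Θ := by
  obtain ⟨c, hc, hle⟩ := exists_pos_le_energy hΘ
  obtain ⟨u, v, hu, hv, hQ⟩ := exists_inS_svirial_eq_zero hΘ
  refine ⟨⟨u, v, hu, hv, hQ⟩, ⟨c, hle⟩, hc.trans_le ?_⟩
  refine le_csInf ⟨_, u, v, hu, hv, hQ, rfl⟩ ?_
  rintro _ ⟨u', v', hu', hv', hQ', rfl⟩
  exact hle u' v' hu' hv' hQ'

end Waveguide
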